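/- Let a finite HMM on hidden space H and observation space O satisfy the low-rank transition assumption with rank d, with factorization P(h'|h) = w*(h')ᵀψ*(h). Then for every k ≥ 2, every observation history o_{1:k−1} with P(o_{1:k−1}) > 0, and every o ∈ O, the conditional next-observation probability factorizes as P(o_k = o | o_{1:k−1}) = μ(o)ᵀ φ(o_{1:k−1}), where μ(o) := Σ_{h∈H} T(o|h) w*(h) ∈ ℝ^d and φ(o_{1:k−1}) := Σ_{h'∈H} ψ*(h') b(o_{1:k−1})(h') ∈ ℝ^d, and b(o_{1:k−1}) is the belief state (posterior distribution of h_{k−1} given o_{1:k−1}). -/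

import Mathlib

/-!
STATEMENT 3: Low-rank factorization of the conditional next-observation
probability: `P(o_k = o | o_{1:k−1}) = μ(o)ᵀ φ(o_{1:k−1})`.
-/

open Finset

/-- A probability distribution on a finite type. -/
def IsDist {S : Type*} [Fintype S] (f : S → ℝ) : Prop :=
  (∀ x, 0 ≤ f x) ∧ ∑ x, f x = 1

/-- Joint probability of a hidden path and an observation sequence. -/
noncomputable def hmmJoint {H O : Type*} [Fintype H]
    (ν : H → ℝ) (P : H → H → ℝ) (T : H → O → ℝ)
    {k : ℕ} (hp : Fin k → H) (o : Fin k → O) : ℝ :=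
  ∏ s : Fin k,
    (T (hp s) (o s) *
      (if (s : ℕ) = 0 then ν (hp s)
       else P (hp ⟨(s : ℕ) - 1, by have := s.isLt; omega⟩) (hp s)))

/-- Marginal probability of an observation sequence. -/
noncomputable def hmmObs {H O : Type*} [Fintype H]
    (ν : H → ℝ) (P : H → H → ℝ) (T : H → O → ℝ)
    {k : ℕ} (o : Fin k → O) : ℝ :=
  ∑ hp : Fin k → H, hmmJoint ν P T hp o

/-- Conditional probability of the next observation given the history. -/
noncomputable def hmmCondNext {H O : Type*} [Fintype H]
    (ν : H → ℝ) (P : H → H → ℝ) (T : H → O → ℝ)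
    {k : ℕ} (o : Fin k → O) (o' : O) : ℝ :=
  hmmObs ν P T (Fin.snoc o o') / hmmObs ν P T o

/-- The belief state `b(o_{1:k})(h) = P(h_k = h | o_{1:k})`. -/
noncomputable def hmmBelief {H O : Type*} [Fintype H] [DecidableEq H]
    (ν : H → ℝ) (P : H → H → ℝ) (T : H → O → ℝ)
    {k : ℕ} (hk : 0 < k) (o : Fin k → O) (h : H) : ℝ :=
  (∑ hp : Fin k → H,
      if hp ⟨k - 1, Nat.sub_lt hk one_pos⟩ = h then hmmJoint ν P T hp o else 0) /
    hmmObs ν P T o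

/-- Appending a hidden state and an observation multiplies the joint probability by the
transition and emission probabilities of the new step. -/
theorem hmmJoint_snoc {H O : Type*} [Fintype H]
    (ν : H → ℝ) (P : H → H → ℝ) (T : H → O → ℝ) {k : ℕ} (hk : 0 < k)
    (hp : Fin k → H) (o : Fin k → O) (h : H) (o' : O) :
    hmmJoint ν P T (Fin.snoc hp h : Fin (k + 1) → H) (Fin.snoc o o' : Fin (k + 1) → O) =
      hmmJoint ν P T hp o * (T h o' * P (hp ⟨k - 1, Nat.sub_lt hk one_pos⟩) h) := by
  have snoc_mk (i : ℕ) (hi : i < k) (hi' : i < k + 1) :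
      (Fin.snoc hp h : Fin (k + 1) → H) ⟨i, hi'⟩ = hp ⟨i, hi⟩ :=
    Fin.snoc_castSucc (α := fun _ => H) h hp ⟨i, hi⟩
  unfold hmmJoint
  rw [Fin.prod_univ_castSucc]
  congr 1
  · refine Finset.prod_congr rfl fun s _ => ?_
    simp only [Fin.snoc_castSucc, Fin.val_castSucc]
    rw [snoc_mk _ (by omega)]
  · simp only [Fin.snoc_last, Fin.val_last, hk.ne', if_false]
    rw [snoc_mk _ (by omega)]

/-- The probability of an extended observation sequence, as a sum over paths of the history
and the new hidden state. -/
theorem hmmObs_snoc {H O : Type*} [Fintype H]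
    (ν : H → ℝ) (P : H → H → ℝ) (T : H → O → ℝ) {k : ℕ} (hk : 0 < k)
    (o : Fin k → O) (o' : O) :
    hmmObs ν P T (Fin.snoc o o' : Fin (k + 1) → O) =
      ∑ h : H, ∑ hp : Fin k → H,
        hmmJoint ν P T hp o * (T h o' * P (hp ⟨k - 1, Nat.sub_lt hk one_pos⟩) h) := by
  unfold hmmObs
  rw [← (Fin.snocEquiv fun _ : Fin (k + 1) => H).sum_comp, Fintype.sum_prod_type]
  exact Finset.sum_congr rfl fun h _ => Finset.sum_congr rfl fun hp _ =>
    hmmJoint_snoc ν P T hk hp o h o'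

/-- The expectation of a function of the current hidden state under the belief state. -/
theorem sum_mul_hmmBelief {H O : Type*} [Fintype H] [DecidableEq H]
    (ν : H → ℝ) (P : H → H → ℝ) (T : H → O → ℝ) {k : ℕ} (hk : 0 < k)
    (o : Fin k → O) (f : H → ℝ) :
    ∑ h, f h * hmmBelief ν P T hk o h =
      (∑ hp : Fin k → H, hmmJoint ν P T hp o * f (hp ⟨k - 1, Nat.sub_lt hk one_pos⟩)) /
        hmmObs ν P T o := by
  simp only [hmmBelief, ← mul_div_assoc, ← Finset.sum_div, Finset.mul_sum]
  rw [Finset.sum_comm]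
  simp [mul_comm]

theorem cond_next_low_rank_factorization
    {H O : Type*} [Fintype H] [DecidableEq H] [Fintype O]
    (ν : H → ℝ) (P : H → H → ℝ) (T : H → O → ℝ)
    (hν : IsDist ν) (hP : ∀ h, IsDist (P h)) (hT : ∀ h, IsDist (T h))
    -- low-rank transition structure of rank d
    (d : ℕ) (w ψ : H → Fin d → ℝ)
    (hlow : ∀ h h', P h h' = ∑ i, w h' i * ψ h i)
    -- an observation history of length K = k−1 ≥ 1 with positive probability
    (K : ℕ) (hK : 0 < K) (o : Fin K → O) (hpos : 0 < hmmObs ν P T o) (o' : O) :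
    hmmCondNext ν P T o o' =
      ∑ i : Fin d,
        (∑ h : H, T h o' * w h i) *
          (∑ h' : H, ψ h' i * hmmBelief ν P T hK o h') := by
  have key (h : H) :
      ∑ hp : Fin K → H, hmmJoint ν P T hp o *
          (T h o' * P (hp ⟨K - 1, Nat.sub_lt hK one_pos⟩) h) =
        ∑ i, T h o' * w h i *
          ∑ hp : Fin K → H, hmmJoint ν P T hp o * ψ (hp ⟨K - 1, Nat.sub_lt hK one_pos⟩) i := by
    simp only [hlow, Finset.mul_sum]
    rw [Finset.sum_comm]
    exact Finset.sum_congr rfl fun _ _ => Finset.sum_congr rfl fun _ _ => by ring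
  simp only [fun i => sum_mul_hmmBelief ν P T hK o fun h => ψ h i]
  rw [hmmCondNext, hmmObs_snoc ν P T hK]
  simp only [key, ← mul_div_assoc, ← Finset.sum_div]
  rw [Finset.sum_comm]
  simp only [Finset.sum_mul]
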